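/- arXiv:2605.16731 — 8 statements merged into one kernel-verified Lean document; each statement's English description precedes it below -/
import Mathlib

section
/- Suppose each f_i is L-smooth and L̃ > L. Then for every x ∈ E and every η ∈ E with p_x(η) ≤ 0, one has F_i(x) − F_i(x+η) ≥ ((L̃ − L)/2)·‖η‖² for every i = 1,…,m. In particular this applies to any minimizer η of p_x (for which p_x(η) ≤ p_x(0) = 0), so each proximal gradient step x ↦ x + η decreases every objective F_i by at least ((L̃ − L)/2)·‖η‖². -/
open RealInnerProductSpace

/-- **Descent lemma (Euclidean instance of Lemma 3.2).**
If each `f i` is `L`-smooth and `L̃ > L`, then any `η` with `p_x(η) ≤ 0`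
(in particular any minimizer of `p_x`) decreases every objective
`F_i = f_i + g_i` by at least `((L̃ - L)/2)·‖η‖²`. -/
theorem descent_lemma
    {E : Type*} [NormedAddCommGroup E] [InnerProductSpace ℝ E] [CompleteSpace E]
    {ι : Type*} [Fintype ι] [Nonempty ι]
    (f g : ι → E → ℝ) (f' : ι → E → E)
    (hgrad : ∀ i x, HasGradientAt (f i) (f' i x) x)
    (hgradcont : ∀ i, Continuous (f' i))
    (L Ltilde : ℝ)
    (hsmooth : ∀ i (x η : E), f i (x + η) ≤ f i x + ⟪f' i x, η⟫ + L / 2 * ‖η‖ ^ 2)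
    (hL : L < Ltilde)
    (x η : E)
    (hp : (Finset.univ.sup' Finset.univ_nonempty
            (fun i => ⟪f' i x, η⟫ + g i (x + η) - g i x))
          + Ltilde / 2 * ‖η‖ ^ 2 ≤ 0) :
    ∀ i, (f i x + g i x) - (f i (x + η) + g i (x + η))
        ≥ (Ltilde - L) / 2 * ‖η‖ ^ 2 := by
  intro i
  have hle := Finset.le_sup' (fun i => ⟪f' i x, η⟫ + g i (x + η) - g i x) (Finset.mem_univ i)
  have hi := hsmooth i x η
  linarith
end

section
/- Let E be a real inner product space, let c_1,…,c_m ∈ E, x ∈ E, L̃ > 0, and let g_1,…,g_m : E → ℝ be convex. If 0 minimizes the function η ↦ max_{i=1,…,m} ( ⟨c_i, η⟩ + g_i(x+η) − g_i(x) ) + (L̃/2)‖η‖² over E, then for every d ∈ E and every t > 0 one has max_{i=1,…,m} ( t·⟨c_i, d⟩ + g_i(x+t·d) − g_i(x) ) ≥ 0; in particular, taking t = 1, max_{i=1,…,m} ( ⟨c_i, d⟩ + g_i(x+d) − g_i(x) ) ≥ 0 for all d ∈ E. -/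
open RealInnerProductSpace

/-- A convex function changes by at most the fraction `s` of its full increment
when only the fraction `s` of the step `d` is taken. -/
theorem ConvexOn.map_add_smul_sub_le {E : Type*} [AddCommGroup E] [Module ℝ E]
    {f : E → ℝ} (hf : ConvexOn ℝ Set.univ f) (x d : E) {s : ℝ} (hs0 : 0 ≤ s) (hs1 : s ≤ 1) :
    f (x + s • d) - f x ≤ s * (f (x + d) - f x) := by
  have h := hf.2 (Set.mem_univ x) (Set.mem_univ (x + d)) (sub_nonneg.2 hs1) hs0 (by ring)
  have hx : (1 - s) • x + s • (x + d) = x + s • d := by module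
  rw [hx, smul_eq_mul, smul_eq_mul] at h
  linarith

/-- **Zero step implies Pareto stationarity (Euclidean instance of Theorem 3.1(1)).**
If `0` minimizes `η ↦ max_i (⟪c i, η⟫ + g i (x+η) - g i x) + (L̃/2)‖η‖²`,
then for every direction `d` and every `t > 0`,
`max_i (t⟪c i, d⟫ + g i (x + t•d) - g i x) ≥ 0`;
in particular (with `t = 1`), `max_i (⟪c i, d⟫ + g i (x+d) - g i x) ≥ 0`. -/
theorem zero_step_pareto_stationary
    {E : Type*} [NormedAddCommGroup E] [InnerProductSpace ℝ E]
    {ι : Type*} [Fintype ι] [Nonempty ι]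
    (c : ι → E) (x : E) (Ltilde : ℝ) (hLtilde : 0 < Ltilde)
    (g : ι → E → ℝ) (hg : ∀ i, ConvexOn ℝ Set.univ (g i))
    (hmin : ∀ η : E,
      (Finset.univ.sup' Finset.univ_nonempty
          (fun i => ⟪c i, (0 : E)⟫ + g i (x + 0) - g i x))
        + Ltilde / 2 * ‖(0 : E)‖ ^ 2
      ≤ (Finset.univ.sup' Finset.univ_nonempty
          (fun i => ⟪c i, η⟫ + g i (x + η) - g i x))
        + Ltilde / 2 * ‖η‖ ^ 2) :
    (∀ (d : E) (t : ℝ), 0 < t →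
      0 ≤ Finset.univ.sup' Finset.univ_nonempty
            (fun i => t * ⟪c i, d⟫ + g i (x + t • d) - g i x)) ∧
    (∀ d : E,
      0 ≤ Finset.univ.sup' Finset.univ_nonempty
            (fun i => ⟪c i, d⟫ + g i (x + d) - g i x)) := by
  have key : ∀ d : E, 0 ≤ Finset.univ.sup' Finset.univ_nonempty
      (fun i => ⟪c i, d⟫ + g i (x + d) - g i x) := by
    intro d
    by_contra! hM
    set M := Finset.univ.sup' Finset.univ_nonempty
      (fun i => ⟪c i, d⟫ + g i (x + d) - g i x) with hMdef
    have hK : 0 ≤ Ltilde * ‖d‖ ^ 2 := by positivity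
    have hpos : 0 < Ltilde * ‖d‖ ^ 2 - M := by linarith
    obtain ⟨s, hs⟩ : ∃ s, s = -M / (Ltilde * ‖d‖ ^ 2 - M) := ⟨_, rfl⟩
    have hs0 : 0 < s := hs ▸ div_pos (by linarith) hpos
    have hs1 : s ≤ 1 := by rw [hs, div_le_one hpos]; linarith
    have hsM : s * (Ltilde * ‖d‖ ^ 2 - M) = -M := by rw [hs, div_mul_cancel₀ _ hpos.ne']
    have hsup : Finset.univ.sup' Finset.univ_nonempty
        (fun i => ⟪c i, s • d⟫ + g i (x + s • d) - g i x) ≤ s * M := by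
      refine Finset.sup'_le _ _ fun i hi => ?_
      have hi' : ⟪c i, d⟫ + g i (x + d) - g i x ≤ M :=
        Finset.le_sup' (fun i => ⟪c i, d⟫ + g i (x + d) - g i x) hi
      have hconv := (hg i).map_add_smul_sub_le x d hs0.le hs1
      have hmul := mul_le_mul_of_nonneg_left hi' hs0.le
      rw [real_inner_smul_right]
      linarith
    have h := hmin (s • d)
    simp only [inner_zero_right, add_zero, zero_add, sub_self, Finset.sup'_const, norm_zero,
      norm_smul, Real.norm_eq_abs, mul_pow, sq_abs] at h
    have h0 : 0 ≤ s * (M + Ltilde / 2 * (s * ‖d‖ ^ 2)) := by linarith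
    have h1 := nonneg_of_mul_nonneg_right h0 hs0
    have h2 : s * M < 0 := mul_neg_of_pos_of_neg hs0 hM
    linarith
  refine ⟨fun d t _ => ?_, key⟩
  simpa only [real_inner_smul_right] using key (t • d)
end

section
/- Assume each f_i is convex, continuously differentiable and L-smooth, each g_i is convex and continuous, and L̃ ≥ L. Fix x ∈ E and let η_x be a minimizer of p_x over E. Then there exist real numbers λ_1,…,λ_m ≥ 0 with ∑_{i=1}^m λ_i = 1 such that for every ξ ∈ E, ∑_{i=1}^m λ_i·F_i(x+η_x) ≤ ∑_{i=1}^m λ_i·F_i(x+ξ) + (L̃/2)·( ‖ξ‖² − ‖ξ − η_x‖² ). -/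
open RealInnerProductSpace Finset

theorem ConvexOn.add_inner_gradient_le
    {E : Type*} [NormedAddCommGroup E] [InnerProductSpace ℝ E] [CompleteSpace E]
    {f : E → ℝ} {f' x : E} (hf : ConvexOn ℝ Set.univ f) (hg : HasGradientAt f f' x) (ξ : E) :
    f x + ⟪f', ξ⟫ ≤ f (x + ξ) := by
  have hc : ConvexOn ℝ Set.univ (fun t : ℝ => f (AffineMap.lineMap x (x + ξ) t)) := by
    simpa using! hf.comp_affineMap (AffineMap.lineMap x (x + ξ) : ℝ →ᵃ[ℝ] E)
  have hd : HasDerivAt (fun t : ℝ => f (AffineMap.lineMap x (x + ξ) t)) ⟪f', ξ⟫ 0 := by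
    have hl : HasDerivAt (fun t : ℝ => AffineMap.lineMap x (x + ξ) t) ξ 0 := by
      simpa using! AffineMap.hasDerivAt_lineMap (a := x) (b := x + ξ) (x := (0 : ℝ))
    have hF : HasFDerivAt f (InnerProductSpace.toDual ℝ E f')
        (AffineMap.lineMap x (x + ξ) (0 : ℝ)) := by
      simpa using hg.hasFDerivAt
    simpa using! hF.comp_hasDerivAt (0 : ℝ) hl
  have h := hc.le_slope_of_hasDerivAt (Set.mem_univ 0) (Set.mem_univ 1) one_pos hd
  simp [slope_def_field] at h
  linarith

/-- A convex theorem of the alternative: finitely many convex functions that are never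
simultaneously negative have a convex combination that is nonnegative. -/
theorem exists_convexCombination_nonneg
    {E : Type*} [AddCommGroup E] [Module ℝ E] {ι : Type*} [Fintype ι] {s : Set E}
    (hs : s.Nonempty) {q : ι → E → ℝ} (hq : ∀ i, ConvexOn ℝ s (q i))
    (hpos : ∀ ξ ∈ s, ∃ i, 0 ≤ q i ξ) :
    ∃ lam : ι → ℝ, (∀ i, 0 ≤ lam i) ∧ ∑ i, lam i = 1 ∧ ∀ ξ ∈ s, 0 ≤ ∑ i, lam i * q i ξ := by
  classical
  obtain ⟨ξ₀, hξ₀⟩ := hs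
  let A : Set (ι → ℝ) := Set.univ.pi fun _ => Set.Iio 0
  let C : Set (ι → ℝ) := {y | ∃ ξ ∈ s, ∀ i, q i ξ ≤ y i}
  have hA : Convex ℝ A := convex_pi fun _ _ => convex_Iio 0
  have hAo : IsOpen A := isOpen_set_pi Set.finite_univ fun _ _ => isOpen_Iio
  have hC : Convex ℝ C := by
    rintro y ⟨ξ, hξ, hy⟩ z ⟨ζ, hζ, hz⟩ a b ha hb hab
    refine ⟨a • ξ + b • ζ, (hq (hpos ξ hξ).choose).1 hξ hζ ha hb hab, fun i => ?_⟩
    refine ((hq i).2 hξ hζ ha hb hab).trans ?_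
    simp only [smul_eq_mul, Pi.add_apply, Pi.smul_apply]
    gcongr
    · exact hy i
    · exact hz i
  have hAC : Disjoint A C := by
    rw [Set.disjoint_left]
    rintro y hy ⟨ξ, hξ, hle⟩
    obtain ⟨i, hi⟩ := hpos ξ hξ
    have : y i < 0 := hy i (Set.mem_univ i)
    linarith [hle i]
  obtain ⟨φ, u, hφA, hφC⟩ := geometric_hahn_banach_open hA hAo hC hAC
  set μ : ι → ℝ := fun i => φ (Pi.single i 1) with hμ
  have hφ (y : ι → ℝ) : φ y = ∑ i, μ i * y i := by
    rw [← φ.coe_coe, LinearMap.pi_apply_eq_sum_univ]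
    refine sum_congr rfl fun i _ => ?_
    have : (fun j => if i = j then (1 : ℝ) else 0) = Pi.single i 1 := by
      ext j
      simp [Pi.single_apply, eq_comm]
    rw [smul_eq_mul, mul_comm, this]
    rfl
  have hneg (t : ℝ) (ht : 0 < t) : -t * ∑ i, μ i < u := by
    have h := hφA (fun _ => -t) fun _ _ => neg_lt_zero.mpr ht
    rwa [hφ, ← sum_mul, mul_comm] at h
  have hμ0 (i : ι) : 0 ≤ μ i := by
    by_contra! hi
    let t : ℝ := (|u - φ (fun j => q j ξ₀)| + 1) / -μ i
    have ht : 0 < t := div_pos (by positivity) (by linarith)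
    have hmem : (fun j => q j ξ₀) + t • Pi.single i (1 : ℝ) ∈ C := by
      refine ⟨ξ₀, hξ₀, fun j => ?_⟩
      by_cases hj : j = i
      · subst hj; simp [ht.le]
      · simp [hj]
    have h := hφC _ hmem
    rw [map_add, map_smul, smul_eq_mul] at h
    have h2 : t * μ i = -(|u - φ (fun j => q j ξ₀)| + 1) := by
      have := hi.ne
      simp only [t]; field_simp
    change u ≤ _ + t * μ i at h
    linarith [neg_abs_le (u - φ (fun j => q j ξ₀)), le_abs_self (u - φ (fun j => q j ξ₀))]
  have hS : 0 ≤ ∑ i, μ i := sum_nonneg fun i _ => hμ0 i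
  have hu : 0 ≤ u := by
    refine le_of_forall_pos_le_add fun ε hε => ?_
    have h := hneg (ε / (∑ i, μ i + 1)) (by positivity)
    have h2 : ε / (∑ i, μ i + 1) * ∑ i, μ i ≤ ε := by
      rw [div_mul_eq_mul_div, div_le_iff₀ (by positivity)]
      nlinarith
    linarith
  have hq0 (ξ : E) (hξ : ξ ∈ s) : 0 ≤ ∑ i, μ i * q i ξ :=
    hu.trans ((hφC (fun i => q i ξ) ⟨ξ, hξ, fun _ => le_rfl⟩).trans_eq (hφ _))
  have hS' : 0 < ∑ i, μ i := by
    refine hS.lt_of_ne fun h => ?_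
    have hz : ∀ i, μ i = 0 := by
      simpa using (sum_eq_zero_iff_of_nonneg fun i _ => hμ0 i).mp h.symm
    have h1 := hneg 1 one_pos
    have h2 := hφC (fun i => q i ξ₀) ⟨ξ₀, hξ₀, fun _ => le_rfl⟩
    rw [hφ] at h2
    simp only [hz, zero_mul, sum_const_zero, mul_zero] at h1 h2
    linarith
  refine ⟨fun i => μ i / ∑ j, μ j, fun i => div_nonneg (hμ0 i) hS, ?_, fun ξ hξ => ?_⟩
  · rw [← sum_div, div_self hS'.ne']
  · simp only [div_mul_eq_mul_div]
    rw [← sum_div]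
    exact div_nonneg (hq0 ξ hξ) hS

/-- First-order optimality condition for a minimizer of a finite maximum of convex functions
plus a quadratic. -/
theorem exists_le_add_inner_of_sup'_add_sq_min
    {E : Type*} [NormedAddCommGroup E] [InnerProductSpace ℝ E]
    {ι : Type*} [Fintype ι] [Nonempty ι] {h : ι → E → ℝ}
    (hh : ∀ i, ConvexOn ℝ Set.univ (h i)) {c : ℝ} {z : E}
    (hmin : ∀ η : E, univ.sup' univ_nonempty (fun i => h i z) + c / 2 * ‖z‖ ^ 2
      ≤ univ.sup' univ_nonempty (fun i => h i η) + c / 2 * ‖η‖ ^ 2) (ξ : E) :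
    ∃ i, univ.sup' univ_nonempty (fun i => h i z) ≤ h i ξ + c * ⟪z, ξ - z⟫ := by
  by_contra! hlt
  set M := univ.sup' univ_nonempty (fun i => h i z) with hM
  obtain ⟨j, -, hj⟩ := exists_mem_eq_sup' univ_nonempty (fun i => h i ξ)
  set d := ξ - z with hd
  set a := M - (h j ξ + c * ⟪z, d⟫) with ha
  have ha0 : 0 < a := sub_pos.mpr (hlt j)
  set K := |c| / 2 * ‖d‖ ^ 2 with hK
  have hK0 : 0 ≤ K := by positivity
  set t := a / (a + K + 1) with ht
  have hden : 0 < a + K + 1 := by positivity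
  have ht0 : 0 < t := by positivity
  have hta : t * (a + K + 1) = a := div_mul_cancel₀ _ hden.ne'
  have ht1 : t ≤ 1 := (div_le_one hden).mpr (by linarith)
  have hsup : univ.sup' univ_nonempty (fun i => h i ((1 - t) • z + t • ξ))
      ≤ (1 - t) * M + t * h j ξ := by
    refine sup'_le _ _ fun i _ => ?_
    refine ((hh i).2 (Set.mem_univ z) (Set.mem_univ ξ) (sub_nonneg.mpr ht1) ht0.le
      (sub_add_cancel 1 t)).trans ?_
    simp only [smul_eq_mul]
    have h1 : h i z ≤ M := le_sup' (fun i => h i z) (mem_univ i)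
    have h2 : h i ξ ≤ h j ξ := hj ▸ le_sup' (fun i => h i ξ) (mem_univ i)
    have := sub_nonneg.mpr ht1
    gcongr
  have hnorm : ‖(1 - t) • z + t • ξ‖ ^ 2 = ‖z‖ ^ 2 + 2 * t * ⟪z, d⟫ + t ^ 2 * ‖d‖ ^ 2 := by
    have : (1 - t) • z + t • ξ = z + t • d := by rw [hd]; module
    rw [this, norm_add_sq_real, inner_smul_right, norm_smul, mul_pow, Real.norm_eq_abs, sq_abs]
    ring
  have hm := hmin ((1 - t) • z + t • ξ)
  rw [hnorm] at hm
  have hcK : c / 2 * ‖d‖ ^ 2 ≤ K := by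
    rw [hK]
    gcongr
    exact le_abs_self c
  have hkey : t * a ≤ t * (t * (c / 2 * ‖d‖ ^ 2)) := by
    rw [ha]
    linarith
  have hkey' : a ≤ t * K :=
    (le_of_mul_le_mul_left hkey ht0).trans (mul_le_mul_of_nonneg_left hcK ht0.le)
  have : 0 < t * a := by positivity
  linarith

/-- **Key rate lemma (Euclidean instance of Lemma 4.2).**
Let `η_x` minimize `p_x(η) = max_i(⟪∇f_i(x),η⟫ + g_i(x+η) - g_i(x)) + (L̃/2)‖η‖²`.
Then there exist KKT multipliers `λ ∈ Δ_m` such that for every `ξ`,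
`∑ λ_i F_i(x+η_x) ≤ ∑ λ_i F_i(x+ξ) + (L̃/2)(‖ξ‖² - ‖ξ - η_x‖²)`. -/
theorem rate_key_lemma
    {E : Type*} [NormedAddCommGroup E] [InnerProductSpace ℝ E] [CompleteSpace E]
    {ι : Type*} [Fintype ι] [Nonempty ι]
    (f g : ι → E → ℝ) (f' : ι → E → E)
    (hfconv : ∀ i, ConvexOn ℝ Set.univ (f i))
    (hgrad : ∀ i x, HasGradientAt (f i) (f' i x) x)
    (hgradcont : ∀ i, Continuous (f' i))
    (L Ltilde : ℝ)
    (hsmooth : ∀ i (x η : E), f i (x + η) ≤ f i x + ⟪f' i x, η⟫ + L / 2 * ‖η‖ ^ 2)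
    (hgconv : ∀ i, ConvexOn ℝ Set.univ (g i))
    (hgcont : ∀ i, Continuous (g i))
    (hL : L ≤ Ltilde)
    (x ηx : E)
    (hmin : ∀ η : E,
      (univ.sup' univ_nonempty (fun i => ⟪f' i x, ηx⟫ + g i (x + ηx) - g i x))
        + Ltilde / 2 * ‖ηx‖ ^ 2
      ≤ (univ.sup' univ_nonempty (fun i => ⟪f' i x, η⟫ + g i (x + η) - g i x))
        + Ltilde / 2 * ‖η‖ ^ 2) :
    ∃ lam : ι → ℝ, (∀ i, 0 ≤ lam i) ∧ (∑ i, lam i = 1) ∧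
      ∀ ξ : E,
        ∑ i, lam i * (f i (x + ηx) + g i (x + ηx))
          ≤ ∑ i, lam i * (f i (x + ξ) + g i (x + ξ))
            + Ltilde / 2 * (‖ξ‖ ^ 2 - ‖ξ - ηx‖ ^ 2) := by
  have hconv (i : ι) :
      ConvexOn ℝ Set.univ fun η => ⟪f' i x, η⟫ + g i (x + η) - g i x := by
    have h1 : ConvexOn ℝ Set.univ fun η => ⟪f' i x, η⟫ :=
      (innerₛₗ ℝ (f' i x)).convexOn convex_univ
    have h2 : ConvexOn ℝ Set.univ fun η => g i (x + η) := by
      simpa using! (hgconv i).translate_right x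
    simpa [sub_eq_add_neg] using! (h1.add h2).add_const (-g i x)
  set M := univ.sup' univ_nonempty (fun i => ⟪f' i x, ηx⟫ + g i (x + ηx) - g i x) with hM
  have hconv' (i : ι) : ConvexOn ℝ Set.univ fun η =>
      ⟪f' i x, η⟫ + g i (x + η) - g i x + ⟪Ltilde • ηx, η⟫ + (-(Ltilde * ⟪ηx, ηx⟫) - M) :=
    ((hconv i).add ((innerₛₗ ℝ (Ltilde • ηx)).convexOn convex_univ)).add_const _
  obtain ⟨lam, hlam0, hlam1, hlam⟩ := exists_convexCombination_nonneg ⟨ηx, Set.mem_univ ηx⟩ hconv'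
    fun ξ _ => by
      obtain ⟨i, hi⟩ := exists_le_add_inner_of_sup'_add_sq_min hconv hmin ξ
      refine ⟨i, ?_⟩
      rw [inner_sub_right] at hi
      rw [real_inner_smul_left]
      linarith
  refine ⟨lam, hlam0, hlam1, fun ξ => ?_⟩
  have hterm (i : ι) : f i (x + ηx) + g i (x + ηx)
      + (⟪f' i x, ξ⟫ + g i (x + ξ) - g i x + ⟪Ltilde • ηx, ξ⟫ + (-(Ltilde * ⟪ηx, ηx⟫) - M))
      ≤ f i (x + ξ) + g i (x + ξ) + Ltilde / 2 * (‖ξ‖ ^ 2 - ‖ξ - ηx‖ ^ 2) := by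
    have h1 := (hfconv i).add_inner_gradient_le (hgrad i x) ξ
    have h2 := hsmooth i x ηx
    have h3 : ⟪f' i x, ηx⟫ + g i (x + ηx) - g i x ≤ M :=
      le_sup' (fun i => ⟪f' i x, ηx⟫ + g i (x + ηx) - g i x) (mem_univ i)
    have h4 : L / 2 * ‖ηx‖ ^ 2 ≤ Ltilde / 2 * ‖ηx‖ ^ 2 := by gcongr
    rw [norm_sub_sq_real, real_inner_smul_left, real_inner_self_eq_norm_sq, real_inner_comm ξ ηx]
    linarith
  have hsum := sum_le_sum fun i (_ : i ∈ univ) => mul_le_mul_of_nonneg_left (hterm i) (hlam0 i)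
  have hnonneg := hlam ξ (Set.mem_univ ξ)
  simp only [mul_add _ (f _ _ + g _ _), sum_add_distrib, ← sum_mul, hlam1, one_mul] at hsum
  linarith
end

section
/- Assume each f_i is convex, continuously differentiable and L-smooth, each g_i is convex and continuous, and L̃ ≥ L. Let x_0 ∈ E and define iterates by letting η_k be a minimizer of p_{x_k} over E and setting x_{k+1} = x_k + η_k. Suppose x_* ∈ E satisfies F_i(x_*) ≤ F_i(x_k) for every i = 1,…,m and every k (as holds for any accumulation point of the iterates). Then for every integer k ≥ 1, min_{i=1,…,m} ( F_i(x_k) − F_i(x_*) ) ≤ L̃·‖x_* − x_0‖²/(2k). -/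
open RealInnerProductSpace Finset

/-- A convex function lies above its tangent at any point where it has a gradient. -/
theorem ConvexOn.inner_le_sub_of_hasGradientAt
    {E : Type*} [NormedAddCommGroup E] [InnerProductSpace ℝ E] [CompleteSpace E]
    {f : E → ℝ} (hf : ConvexOn ℝ Set.univ f) {x v : E} (hv : HasGradientAt f v x) (ξ : E) :
    ⟪v, ξ⟫ ≤ f (x + ξ) - f x := by
  have hline : HasDerivAt (fun t : ℝ => x + t • ξ) ξ 0 := by
    simpa using ((hasDerivAt_id (0 : ℝ)).smul_const ξ).const_add x
  have hderiv : HasDerivAt (fun t : ℝ => f (x + t • ξ)) ⟪v, ξ⟫ 0 := by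
    have h : HasFDerivAt f (InnerProductSpace.toDual ℝ E v) (x + (0 : ℝ) • ξ) := by
      simpa using hv.hasFDerivAt
    simpa [Function.comp_def] using h.comp_hasDerivAt (0 : ℝ) hline
  have hconv : ConvexOn ℝ Set.univ (fun t : ℝ => f (x + t • ξ)) := by
    have h := hf.comp_affineMap (AffineMap.lineMap x (x + ξ))
    simpa [Function.comp_def, AffineMap.lineMap_apply, add_comm] using h
  have h := hconv.le_slope_of_hasDerivAt (Set.mem_univ 0) (Set.mem_univ 1) one_pos hderiv
  simpa [slope_def_field] using h

/-- The pointwise maximum of a finite nonempty family of convex functions is convex. -/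
theorem ConvexOn.univ_sup'
    {E ι : Type*} [AddCommGroup E] [Module ℝ E] [Fintype ι] [Nonempty ι]
    {s : Set E} {φ : ι → E → ℝ} (hφ : ∀ i, ConvexOn ℝ s (φ i)) :
    ConvexOn ℝ s (fun y => univ.sup' univ_nonempty (fun i => φ i y)) := by
  refine ⟨(hφ (Classical.arbitrary ι)).1, fun y hy z hz a b ha hb hab => ?_⟩
  refine sup'_le _ _ fun i _ => ((hφ i).2 hy hz ha hb hab).trans ?_
  simp only [smul_eq_mul]
  gcongr
  · exact le_sup' (fun i => φ i y) (mem_univ i)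
  · exact le_sup' (fun i => φ i z) (mem_univ i)

/-- Quadratic growth at a minimizer of a convex function plus a quadratic. -/
theorem ConvexOn.add_sq_norm_sub_le_of_forall_le
    {E : Type*} [NormedAddCommGroup E] [InnerProductSpace ℝ E]
    {ψ : E → ℝ} (hψ : ConvexOn ℝ Set.univ ψ) {c : ℝ} {η : E}
    (hmin : ∀ ξ, ψ η + c / 2 * ‖η‖ ^ 2 ≤ ψ ξ + c / 2 * ‖ξ‖ ^ 2) (ξ : E) :
    ψ η + c / 2 * ‖η‖ ^ 2 + c / 2 * ‖ξ - η‖ ^ 2 ≤ ψ ξ + c / 2 * ‖ξ‖ ^ 2 := by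
  have key : ∀ t ∈ Set.Ioo (0 : ℝ) 1,
      ψ η + c / 2 * ‖η‖ ^ 2 + (1 - t) * (c / 2 * ‖ξ - η‖ ^ 2) ≤ ψ ξ + c / 2 * ‖ξ‖ ^ 2 := by
    rintro t ⟨ht0, ht1⟩
    have h1 := hmin ((1 - t) • η + t • ξ)
    have h2 := hψ.2 (Set.mem_univ η) (Set.mem_univ ξ) (sub_nonneg.2 ht1.le) ht0.le (by ring)
    have h3 : ‖(1 - t) • η + t • ξ‖ ^ 2
        = (1 - t) * ‖η‖ ^ 2 + t * ‖ξ‖ ^ 2 - t * (1 - t) * ‖ξ - η‖ ^ 2 := by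
      rw [norm_add_sq_real, norm_sub_sq_real, norm_smul, norm_smul, inner_smul_left,
        inner_smul_right, real_inner_comm, mul_pow, mul_pow, Real.norm_eq_abs, Real.norm_eq_abs,
        sq_abs, sq_abs]
      simp only [conj_trivial]
      ring
    rw [h3] at h1
    simp only [smul_eq_mul] at h2
    refine le_of_mul_le_mul_left ?_ ht0
    linarith
  have hlim : Filter.Tendsto
      (fun t : ℝ => ψ η + c / 2 * ‖η‖ ^ 2 + (1 - t) * (c / 2 * ‖ξ - η‖ ^ 2))
      (nhdsWithin 0 (Set.Ioi 0)) (nhds (ψ η + c / 2 * ‖η‖ ^ 2 + c / 2 * ‖ξ - η‖ ^ 2)) := by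
    refine Filter.Tendsto.mono_left ?_ nhdsWithin_le_nhds
    refine Continuous.tendsto' (by fun_prop) _ _ (by simp)
  exact le_of_tendsto hlim (Filter.eventually_of_mem (Ioo_mem_nhdsGT one_pos) key)


/-- **Non-ergodic O(1/k) rate (Euclidean instance of Theorem 3.5).**
For the proximal gradient iterates `x_{k+1} = x_k + η_k` and any point `x_*`
with `F_i(x_*) ≤ F_i(x_k)` for all `i` and `k`, one has for every `k ≥ 1`:
`min_i (F_i(x_k) - F_i(x_*)) ≤ L̃‖x_* - x_0‖² / (2k)`. -/
theorem nonergodic_rate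
    {E : Type*} [NormedAddCommGroup E] [InnerProductSpace ℝ E] [CompleteSpace E]
    {ι : Type*} [Fintype ι] [Nonempty ι]
    (f g : ι → E → ℝ) (f' : ι → E → E)
    (hfconv : ∀ i, ConvexOn ℝ Set.univ (f i))
    (hgrad : ∀ i x, HasGradientAt (f i) (f' i x) x)
    (hgradcont : ∀ i, Continuous (f' i))
    (L Ltilde : ℝ)
    (hsmooth : ∀ i (x η : E), f i (x + η) ≤ f i x + ⟪f' i x, η⟫ + L / 2 * ‖η‖ ^ 2)
    (hgconv : ∀ i, ConvexOn ℝ Set.univ (g i))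
    (hgcont : ∀ i, Continuous (g i))
    (hL : L ≤ Ltilde)
    (x η : ℕ → E)
    (hupd : ∀ k, x (k + 1) = x k + η k)
    (hmin : ∀ k (ξ : E),
      (univ.sup' univ_nonempty
          (fun i => ⟪f' i (x k), η k⟫ + g i (x k + η k) - g i (x k)))
        + Ltilde / 2 * ‖η k‖ ^ 2
      ≤ (univ.sup' univ_nonempty
          (fun i => ⟪f' i (x k), ξ⟫ + g i (x k + ξ) - g i (x k)))
        + Ltilde / 2 * ‖ξ‖ ^ 2)
    (xstar : E)
    (hstar : ∀ i k, f i xstar + g i xstar ≤ f i (x k) + g i (x k)) :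
    ∀ k : ℕ, 1 ≤ k →
      univ.inf' univ_nonempty
          (fun i => (f i (x k) + g i (x k)) - (f i xstar + g i xstar))
        ≤ Ltilde * ‖xstar - x 0‖ ^ 2 / (2 * k) := by
  have hcurv : ∀ v : E, 0 ≤ L / 2 * ‖v‖ ^ 2 := fun v => by
    have i := Classical.arbitrary ι
    have h1 := hsmooth i 0 v
    have h2 := (hfconv i).inner_le_sub_of_hasGradientAt (hgrad i 0) v
    linarith
  have hcurv_le : ∀ v : E, L / 2 * ‖v‖ ^ 2 ≤ Ltilde / 2 * ‖v‖ ^ 2 := fun v => by gcongr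
  have hψ : ∀ k, ConvexOn ℝ Set.univ (fun ξ => univ.sup' univ_nonempty
      (fun i => ⟪f' i (x k), ξ⟫ + g i (x k + ξ) - g i (x k))) := fun k =>
    ConvexOn.univ_sup' fun i => by
      have h1 : ConvexOn ℝ Set.univ (fun ξ => ⟪f' i (x k), ξ⟫) :=
        (innerₛₗ ℝ (f' i (x k))).convexOn convex_univ
      have h2 : ConvexOn ℝ Set.univ (fun ξ => g i (x k + ξ)) := by
        simpa [Function.comp_def] using (hgconv i).translate_right (x k)
      simp only [sub_eq_add_neg]
      exact (h1.add h2).add_const (-g i (x k))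
  have hgrowth := fun k => (hψ k).add_sq_norm_sub_le_of_forall_le (hmin k)
  have hdescent : ∀ k i, f i (x (k + 1)) + g i (x (k + 1)) - (f i (x k) + g i (x k))
      ≤ univ.sup' univ_nonempty (fun i => ⟪f' i (x k), η k⟫ + g i (x k + η k) - g i (x k))
        + Ltilde / 2 * ‖η k‖ ^ 2 := fun k i => by
    have h1 := le_sup' (fun i => ⟪f' i (x k), η k⟫ + g i (x k + η k) - g i (x k)) (mem_univ i)
    have h2 := hsmooth i (x k) (η k)
    have h3 := hcurv_le (η k)
    rw [hupd k]
    linarith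
  have hmono : ∀ k i, f i (x (k + 1)) + g i (x (k + 1)) ≤ f i (x k) + g i (x k) := fun k i => by
    have h1 := hdescent k i
    have h2 := hmin k 0
    simp at h2
    linarith
  set a : ℕ → ℝ := fun k => univ.inf' univ_nonempty
    (fun i => (f i (x k) + g i (x k)) - (f i xstar + g i xstar))
  have ha_le : ∀ k i, a k ≤ (f i (x k) + g i (x k)) - (f i xstar + g i xstar) := fun k i =>
    inf'_le _ (mem_univ i)
  have ha_anti : ∀ k, a (k + 1) ≤ a k := fun k =>
    le_inf' _ _ fun i _ => (ha_le (k + 1) i).trans (sub_le_sub_right (hmono k i) _)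
  have ha_succ : ∀ k, a (k + 1) ≤
      Ltilde / 2 * ‖xstar - x k‖ ^ 2 - Ltilde / 2 * ‖xstar - x (k + 1)‖ ^ 2 := fun k => by
    obtain ⟨i, -, hi⟩ := exists_mem_eq_inf' (univ_nonempty (α := ι))
      (fun i => (f i (x k) + g i (x k)) - (f i xstar + g i xstar))
    have h1 := hgrowth k (xstar - x k)
    have h2 : univ.sup' univ_nonempty (fun i => ⟪f' i (x k), xstar - x k⟫
        + g i (x k + (xstar - x k)) - g i (x k)) ≤ -a k := sup'_le _ _ fun j _ => by
      have h3 := (hfconv j).inner_le_sub_of_hasGradientAt (hgrad j (x k)) (xstar - x k)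
      have h4 := ha_le k j
      rw [add_sub_cancel] at h3 ⊢
      linarith
    have h5 := hdescent k i
    have h6 := ha_le (k + 1) i
    have h7 : xstar - x k - η k = xstar - x (k + 1) := by rw [hupd k]; abel
    change a k = _ at hi
    rw [h7] at h1
    linarith
  have htelescope : ∀ k : ℕ,
      k * a k + Ltilde / 2 * ‖xstar - x k‖ ^ 2 ≤ Ltilde / 2 * ‖xstar - x 0‖ ^ 2 := fun k => by
    induction k with
    | zero => simp
    | succ k ih =>
      have h1 := ha_succ k
      have h2 := mul_le_mul_of_nonneg_left (ha_anti k) (Nat.cast_nonneg (α := ℝ) k)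
      push_cast
      linarith
  intro k hk
  have hk' : (0 : ℝ) < k := by exact_mod_cast hk
  have h1 := htelescope k
  have h2 := (hcurv (xstar - x k)).trans (hcurv_le _)
  change a k ≤ _
  rw [le_div_iff₀ (by positivity)]
  linarith
end

section
/- Let E be a real Hilbert space and let ψ : E → ℝ be a continuous convex function. For σ > 0 let η(σ) denote the (unique, by strong convexity) minimizer of η ↦ ψ(η) + (σ/2)‖η‖² over E. Then for any 0 < σ₁ ≤ σ₂ one has σ₁·‖η(σ₁)‖ ≤ σ₂·‖η(σ₂)‖, i.e., ‖η(σ₁)‖ ≤ (σ₂/σ₁)·‖η(σ₂)‖. -/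
open Filter Topology in
/-- If `x` minimizes `z ↦ ψ z + (σ/2)‖z‖²` for a convex `ψ`, then `-σ • x` is a subgradient of `ψ`
at `x`. -/
theorem ConvexOn.subgradient_of_regularized_minimizer
    {E : Type*} [NormedAddCommGroup E] [InnerProductSpace ℝ E]
    {ψ : E → ℝ} (hψ : ConvexOn ℝ Set.univ ψ) {σ : ℝ} {x : E}
    (hx : ∀ z : E, ψ x + σ / 2 * ‖x‖ ^ 2 ≤ ψ z + σ / 2 * ‖z‖ ^ 2) (z : E) :
    ψ x - σ * inner ℝ x (z - x) ≤ ψ z := by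
  have bound : ∀ t ∈ Set.Ioo (0 : ℝ) 1,
      0 ≤ ψ z - ψ x + σ * inner ℝ x (z - x) + t * (σ / 2 * ‖z - x‖ ^ 2) := by
    rintro t ⟨ht0, ht1⟩
    have hconv := hψ.2 (Set.mem_univ x) (Set.mem_univ z) (sub_nonneg.2 ht1.le) ht0.le
      (sub_add_cancel 1 t)
    have hpoint : (1 - t) • x + t • z = x + t • (z - x) := by module
    rw [hpoint, smul_eq_mul, smul_eq_mul] at hconv
    have hmin := hx (x + t • (z - x))
    rw [norm_add_sq_real, inner_smul_right, norm_smul, mul_pow, Real.norm_eq_abs, sq_abs] at hmin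
    refine nonneg_of_mul_nonneg_right (a := t) ?_ ht0
    linarith
  have hlim : Tendsto
      (fun t : ℝ => ψ z - ψ x + σ * inner ℝ x (z - x) + t * (σ / 2 * ‖z - x‖ ^ 2))
      (𝓝[>] 0) (𝓝 (ψ z - ψ x + σ * inner ℝ x (z - x) + 0 * (σ / 2 * ‖z - x‖ ^ 2))) :=
    (Continuous.tendsto (by fun_prop) 0).mono_left nhdsWithin_le_nhds
  have hnonneg := ge_of_tendsto hlim
    (eventually_of_mem (Ioo_mem_nhdsGT zero_lt_one) bound)
  linarith

/-- **Monotonicity of Moreau-type regularized minimizers (Lemma 5.4).**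
If `η(σ)` minimizes `η ↦ ψ(η) + (σ/2)‖η‖²` for each `σ > 0`, then for
`0 < σ₁ ≤ σ₂` one has `σ₁‖η(σ₁)‖ ≤ σ₂‖η(σ₂)‖`, i.e.
`‖η(σ₁)‖ ≤ (σ₂/σ₁)‖η(σ₂)‖`. -/
theorem regularized_minimizer_monotone
    {E : Type*} [NormedAddCommGroup E] [InnerProductSpace ℝ E] [CompleteSpace E]
    (ψ : E → ℝ) (hψcont : Continuous ψ) (hψconv : ConvexOn ℝ Set.univ ψ)
    (η : ℝ → E)
    (hη : ∀ σ : ℝ, 0 < σ → ∀ z : E,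
      ψ (η σ) + σ / 2 * ‖η σ‖ ^ 2 ≤ ψ z + σ / 2 * ‖z‖ ^ 2)
    (σ₁ σ₂ : ℝ) (hσ₁ : 0 < σ₁) (hσ : σ₁ ≤ σ₂) :
    σ₁ * ‖η σ₁‖ ≤ σ₂ * ‖η σ₂‖ ∧ ‖η σ₁‖ ≤ σ₂ / σ₁ * ‖η σ₂‖ := by
  have hσ₂ : 0 < σ₂ := hσ₁.trans_le hσ
  have main : σ₁ * ‖η σ₁‖ ≤ σ₂ * ‖η σ₂‖ := by
    have h₁ := hψconv.subgradient_of_regularized_minimizer (hη σ₁ hσ₁) (η σ₂)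
    have h₂ := hψconv.subgradient_of_regularized_minimizer (hη σ₂ hσ₂) (η σ₁)
    rw [inner_sub_right, real_inner_self_eq_norm_sq] at h₁ h₂
    rw [real_inner_comm] at h₂
    have hcs := mul_le_mul_of_nonneg_left (real_inner_le_norm (η σ₁) (η σ₂))
      (add_pos hσ₁ hσ₂).le
    by_contra! hlt
    have hnorm : ‖η σ₂‖ < ‖η σ₁‖ := lt_of_mul_lt_mul_left
      ((mul_le_mul_of_nonneg_right hσ (norm_nonneg _)).trans_lt hlt) hσ₁.le
    linarith [mul_pos (sub_pos.2 hlt) (sub_pos.2 hnorm)]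
  refine ⟨main, ?_⟩
  rwa [div_mul_eq_mul_div, le_div_iff₀' hσ₁]
end

section
/- Assume each f_i is convex, continuously differentiable and L-smooth, each g_i is convex and continuous, L̃ > L, and each F_i is bounded from below. Let (ε_k) be positive reals with ε_k → 0. Define iterates x_{k+1} = x_k + η̂_k, where η̂_k ∈ E satisfies p_{x_k}(η̂_k) ≤ 0 and there exists v_k ∈ E with p_{x_k}(z) ≥ p_{x_k}(η̂_k) + ⟨v_k, z − η̂_k⟩ for all z ∈ E and ‖v_k‖ ≤ ε_k·‖η̂_k‖. Then ∑_k ‖η̂_k‖² < ∞ (so ‖η̂_k‖ → 0), and every accumulation point x_* of (x_k) is Pareto stationary: for every d ∈ E and every t > 0, max_{i=1,…,m} ( t·⟨∇f_i(x_*), d⟩ + g_i(x_* + t·d) − g_i(x_*) ) ≥ 0. -/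
open RealInnerProductSpace Finset Filter

/-- A sequence bounded below whose decrease dominates `c * u k` makes `u` summable. -/
theorem summable_of_add_mul_le {a u : ℕ → ℝ} {c b : ℝ} (hc : 0 < c) (hu : ∀ k, 0 ≤ u k)
    (hb : ∀ k, b ≤ a k) (h : ∀ k, a (k + 1) + c * u k ≤ a k) : Summable u := by
  have key : ∀ n, c * ∑ k ∈ range n, u k ≤ a 0 - a n := by
    intro n
    induction n with
    | zero => simp
    | succ n ih =>
      rw [sum_range_succ, mul_add]
      linarith [h n]
  refine summable_of_sum_range_le (c := (a 0 - b) / c) hu fun n => ?_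
  rw [le_div_iff₀ hc]
  linarith [key n, hb n]

/-- The linearized model `(x, η) ↦ max_i (⟪∇f_i x, η⟫ + g_i (x + η) - g_i x)` is jointly
continuous. -/
theorem continuous_model {E : Type*} [NormedAddCommGroup E] [InnerProductSpace ℝ E]
    {ι : Type*} [Fintype ι] [Nonempty ι] {g : ι → E → ℝ} {f' : ι → E → E}
    (hf' : ∀ i, Continuous (f' i)) (hg : ∀ i, Continuous (g i)) :
    Continuous fun p : E × E => univ.sup' univ_nonempty
      (fun i => ⟪f' i p.1, p.2⟫ + g i (p.1 + p.2) - g i p.1) := by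
  refine Continuous.finset_sup'_apply _ fun i _ => ?_
  have := hf' i
  have := hg i
  fun_prop

/-- The linearized model is convex and vanishes at `0`, so it is subhomogeneous on `[0, 1]`. -/
theorem model_smul_le {E : Type*} [NormedAddCommGroup E] [InnerProductSpace ℝ E]
    {ι : Type*} [Fintype ι] [Nonempty ι] {g : ι → E → ℝ} {w : ι → E}
    (hg : ∀ i, ConvexOn ℝ Set.univ (g i)) (x z : E) {s : ℝ} (hs0 : 0 ≤ s) (hs1 : s ≤ 1) :
    univ.sup' univ_nonempty (fun i => ⟪w i, s • z⟫ + g i (x + s • z) - g i x) ≤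
      s * univ.sup' univ_nonempty (fun i => ⟪w i, z⟫ + g i (x + z) - g i x) := by
  refine sup'_le _ _ fun i _ => ?_
  have hi := le_sup' (fun i => ⟪w i, z⟫ + g i (x + z) - g i x) (mem_univ i)
  have hc := (hg i).2 (Set.mem_univ x) (Set.mem_univ (x + z)) (sub_nonneg.2 hs1) hs0
    (sub_add_cancel 1 s)
  have hx : (1 - s) • x + s • (x + z) = x + s • z := by module
  rw [hx, smul_eq_mul, smul_eq_mul] at hc
  have hm := mul_le_mul_of_nonneg_left hi hs0
  rw [real_inner_smul_right]
  linarith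

/-- A quantity whose multiples `s * a` are nonnegative up to `O(s ^ 2)` as `s → 0⁺` is
nonnegative. -/
theorem nonneg_of_mul_add_sq_nonneg {a c : ℝ}
    (h : ∀ s : ℝ, 0 < s → s ≤ 1 → 0 ≤ s * a + c * s ^ 2) : 0 ≤ a := by
  have hlim : Tendsto (fun s : ℝ => a + c * s) (nhdsWithin 0 (Set.Ioi 0)) (nhds a) := by
    have : Continuous fun s : ℝ => a + c * s := by fun_prop
    simpa using (this.tendsto 0).mono_left nhdsWithin_le_nhds
  refine ge_of_tendsto hlim ?_
  filter_upwards [Ioc_mem_nhdsGT (zero_lt_one' ℝ)] with s hs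
  refine nonneg_of_mul_nonneg_right (a := s) ?_ hs.1
  linarith [h s hs.1 hs.2]

/-- **Convergence of the inexact proximal gradient method
(Euclidean instance of Theorem 4.2).**
With `p_{x}(η) = max_i(⟪∇f_i(x),η⟫ + g_i(x+η) - g_i(x)) + (L̃/2)‖η‖²`, inexact
steps `η̂_k` with `p_{x_k}(η̂_k) ≤ 0` and a residual subgradient `v_k` satisfying
`‖v_k‖ ≤ ε_k ‖η̂_k‖` (with `ε_k → 0`) yield `∑ ‖η̂_k‖² < ∞` and every
accumulation point of `(x_k)` is Pareto stationary. -/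
theorem inexact_convergence
    {E : Type*} [NormedAddCommGroup E] [InnerProductSpace ℝ E] [CompleteSpace E]
    {ι : Type*} [Fintype ι] [Nonempty ι]
    (f g : ι → E → ℝ) (f' : ι → E → E)
    (hfconv : ∀ i, ConvexOn ℝ Set.univ (f i))
    (hgrad : ∀ i x, HasGradientAt (f i) (f' i x) x)
    (hgradcont : ∀ i, Continuous (f' i))
    (L Ltilde : ℝ)
    (hsmooth : ∀ i (x η : E), f i (x + η) ≤ f i x + ⟪f' i x, η⟫ + L / 2 * ‖η‖ ^ 2)
    (hgconv : ∀ i, ConvexOn ℝ Set.univ (g i))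
    (hgcont : ∀ i, Continuous (g i))
    (hL : L < Ltilde)
    (hFbdd : ∀ i, BddBelow (Set.range fun z => f i z + g i z))
    (ε : ℕ → ℝ) (hεpos : ∀ k, 0 < ε k) (hεlim : Tendsto ε atTop (nhds 0))
    (x ηhat : ℕ → E) (v : ℕ → E)
    (hupd : ∀ k, x (k + 1) = x k + ηhat k)
    (hp0 : ∀ k,
      (univ.sup' univ_nonempty
          (fun i => ⟪f' i (x k), ηhat k⟫ + g i (x k + ηhat k) - g i (x k)))
        + Ltilde / 2 * ‖ηhat k‖ ^ 2 ≤ 0)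
    (hsub : ∀ k (z : E),
      (univ.sup' univ_nonempty
          (fun i => ⟪f' i (x k), z⟫ + g i (x k + z) - g i (x k)))
        + Ltilde / 2 * ‖z‖ ^ 2
      ≥ (univ.sup' univ_nonempty
          (fun i => ⟪f' i (x k), ηhat k⟫ + g i (x k + ηhat k) - g i (x k)))
        + Ltilde / 2 * ‖ηhat k‖ ^ 2 + ⟪v k, z - ηhat k⟫)
    (hv : ∀ k, ‖v k‖ ≤ ε k * ‖ηhat k‖) :
    (Summable fun k => ‖ηhat k‖ ^ 2) ∧
    (Tendsto (fun k => ‖ηhat k‖) atTop (nhds 0)) ∧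
    (∀ xstar : E,
      (∃ φ : ℕ → ℕ, StrictMono φ ∧ Tendsto (fun j => x (φ j)) atTop (nhds xstar)) →
      ∀ (d : E) (t : ℝ), 0 < t →
        0 ≤ univ.sup' univ_nonempty
              (fun i => t * ⟪f' i xstar, d⟫ + g i (xstar + t • d) - g i xstar)) := by
  have hsum : Summable fun k => ‖ηhat k‖ ^ 2 := by
    obtain ⟨i⟩ := ‹Nonempty ι›
    obtain ⟨b, hb⟩ := hFbdd i
    refine summable_of_add_mul_le (a := fun k => f i (x k) + g i (x k)) (b := b)
      (half_pos (sub_pos.2 hL)) (fun k => sq_nonneg _) (fun k => hb ⟨x k, rfl⟩) fun k => ?_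
    have hi := le_sup'
      (fun i => ⟪f' i (x k), ηhat k⟫ + g i (x k + ηhat k) - g i (x k)) (mem_univ i)
    have hs := hsmooth i (x k) (ηhat k)
    have hp := hp0 k
    simp only [hupd]
    linarith
  have hnorm : Tendsto (fun k => ‖ηhat k‖) atTop (nhds 0) := by
    simpa [Real.sqrt_sq] using hsum.tendsto_atTop_zero.sqrt
  refine ⟨hsum, hnorm, ?_⟩
  rintro xstar ⟨φ, hφ, hx⟩ d t -
  have hη : Tendsto (fun j => ηhat (φ j)) atTop (nhds 0) :=
    (tendsto_zero_iff_norm_tendsto_zero.2 hnorm).comp hφ.tendsto_atTop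
  have hv0 : Tendsto (fun j => v (φ j)) atTop (nhds 0) := by
    refine Tendsto.comp (g := v) ?_ hφ.tendsto_atTop
    exact squeeze_zero_norm hv (by simpa using hεlim.mul hnorm)
  have hmodel : ∀ (z : ℕ → E) (z₀ : E), Tendsto z atTop (nhds z₀) →
      Tendsto (fun j => univ.sup' univ_nonempty
          (fun i => ⟪f' i (x (φ j)), z j⟫ + g i (x (φ j) + z j) - g i (x (φ j)))
          + Ltilde / 2 * ‖z j‖ ^ 2) atTop
        (nhds (univ.sup' univ_nonempty
          (fun i => ⟪f' i xstar, z₀⟫ + g i (xstar + z₀) - g i xstar)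
          + Ltilde / 2 * ‖z₀‖ ^ 2)) := fun z z₀ hz =>
    (((continuous_model hgradcont hgcont).tendsto (xstar, z₀)).comp (hx.prodMk_nhds hz)).add
      ((hz.norm.pow 2).const_mul _)
  have hlimit : ∀ z : E, 0 ≤ univ.sup' univ_nonempty
      (fun i => ⟪f' i xstar, z⟫ + g i (xstar + z) - g i xstar) + Ltilde / 2 * ‖z‖ ^ 2 := by
    intro z
    have hr := (hmodel _ 0 hη).add (hv0.inner (tendsto_const_nhds (x := z) |>.sub hη))
    have := le_of_tendsto_of_tendsto' hr (hmodel _ z tendsto_const_nhds)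
      fun j => hsub (φ j) z
    simpa using this
  simp only [← real_inner_smul_right]
  refine nonneg_of_mul_add_sq_nonneg (c := Ltilde / 2 * ‖t • d‖ ^ 2) fun s hs0 hs1 => ?_
  have h1 := hlimit (s • t • d)
  have h2 := model_smul_le (w := fun i => f' i xstar) hgconv xstar (t • d) hs0.le hs1
  rw [norm_smul s, mul_pow, Real.norm_eq_abs, sq_abs] at h1
  linarith
end

section
/- Let 0 < s₁ < s₂ < 1, 0 < τ₁ < 1 < τ₂ < τ₃, and σ_succ > 0, and let (σ_k)_{k∈ℕ} and (ρ_k)_{k∈ℕ} be real sequences with σ_k > 0 for all k, satisfying for every k: (i) if ρ_k ≥ s₂ then σ_{k+1} ≤ σ_k; (ii) if s₁ ≤ ρ_k < s₂ then σ_{k+1} ≤ τ₂·σ_k; (iii) if ρ_k < s₁ then σ_{k+1} ≤ τ₃·σ_k; and (iv) if σ_k ≥ σ_succ then ρ_k ≥ s₂. Then σ_k ≤ max(σ₀, τ₃·σ_succ) for all k ∈ ℕ. -/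
/-- **Uniform boundedness of the trust-region penalty parameter
(abstract form of Proposition 5.1).**
Under the TR-RMPGM update rules (i)–(iii) and the very-successful criterion (iv),
the penalty parameter satisfies `σ_k ≤ max(σ₀, τ₃·σ_succ)` for all `k`. -/
theorem sigma_uniformly_bounded
    (s₁ s₂ τ₁ τ₂ τ₃ σsucc : ℝ)
    (hs₁ : 0 < s₁) (hs₁₂ : s₁ < s₂) (hs₂ : s₂ < 1)
    (hτ₁ : 0 < τ₁) (hτ₁1 : τ₁ < 1) (hτ₂ : 1 < τ₂) (hτ₂₃ : τ₂ < τ₃)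
    (hσsucc : 0 < σsucc)
    (σ ρ : ℕ → ℝ) (hσpos : ∀ k, 0 < σ k)
    (h1 : ∀ k, s₂ ≤ ρ k → σ (k + 1) ≤ σ k)
    (h2 : ∀ k, s₁ ≤ ρ k → ρ k < s₂ → σ (k + 1) ≤ τ₂ * σ k)
    (h3 : ∀ k, ρ k < s₁ → σ (k + 1) ≤ τ₃ * σ k)
    (h4 : ∀ k, σsucc ≤ σ k → s₂ ≤ ρ k) :
    ∀ k, σ k ≤ max (σ 0) (τ₃ * σsucc) := by
  intro k
  induction k with
  | zero => exact le_max_left _ _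
  | succ k ih =>
    rcases le_or_gt s₂ (ρ k) with hρ | hρ
    · exact (h1 k hρ).trans ih
    · have hσ : σ k ≤ σsucc := (lt_of_not_ge fun h => hρ.not_ge (h4 k h)).le
      have hτ₃ : 0 ≤ τ₃ := by linarith
      have hstep : σ (k + 1) ≤ τ₃ * σ k := by
        rcases le_or_gt s₁ (ρ k) with hρ₁ | hρ₁
        · exact (h2 k hρ₁ hρ).trans (mul_le_mul_of_nonneg_right hτ₂₃.le (hσpos k).le)
        · exact h3 k hρ₁
      exact (hstep.trans (mul_le_mul_of_nonneg_left hσ hτ₃)).trans (le_max_right _ _)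
end

section
/- Let s₁ ≤ s₂ be reals, τ₂ > 1, σ_succ > 0, let (σ_k) be a sequence of positive reals, (ρ_k) a sequence of reals, and (a_k) a sequence of nonnegative reals, such that for all k: (i) if ρ_k < s₁ then σ_{k+1} ≥ τ₂·σ_k; and (ii) if σ_k ≥ σ_succ and a_k ≠ 0 then ρ_k ≥ s₂. If there exists K ∈ ℕ such that ρ_k < s₁ for all k ≥ K, then a_k = 0 for some k ≥ K. -/
/-- **Finitely many successful iterations yield a stationary step
(abstract form of Theorem 5.3).**
If `σ` grows by at least the factor `τ₂ > 1` on every unsuccessful iteration,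
and any iteration with `σ_k ≥ σ_succ` and a nonzero step is very successful,
then the tail of unsuccessful iterations must contain a zero step. -/
theorem finitely_many_successful
    (s₁ s₂ : ℝ) (hs : s₁ ≤ s₂) (τ₂ : ℝ) (hτ₂ : 1 < τ₂)
    (σsucc : ℝ) (hσsucc : 0 < σsucc)
    (σ ρ a : ℕ → ℝ) (hσpos : ∀ k, 0 < σ k) (ha : ∀ k, 0 ≤ a k)
    (h1 : ∀ k, ρ k < s₁ → τ₂ * σ k ≤ σ (k + 1))
    (h2 : ∀ k, σsucc ≤ σ k → a k ≠ 0 → s₂ ≤ ρ k)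
    (K : ℕ) (hK : ∀ k, K ≤ k → ρ k < s₁) :
    ∃ k, K ≤ k ∧ a k = 0 := by
  have hgrow : ∀ n, τ₂ ^ n * σ K ≤ σ (K + n) := by
    intro n
    induction n with
    | zero => simp
    | succ n ih =>
      calc τ₂ ^ (n + 1) * σ K = τ₂ * (τ₂ ^ n * σ K) := by ring
        _ ≤ τ₂ * σ (K + n) := by gcongr
        _ ≤ σ (K + n + 1) := h1 _ (hK _ (Nat.le_add_right K n))
  obtain ⟨n, hn⟩ := pow_unbounded_of_one_lt (σsucc / σ K) hτ₂
  have hlarge : σsucc ≤ σ (K + n) := ((div_lt_iff₀ (hσpos K)).mp hn).le.trans (hgrow n)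
  refine ⟨K + n, Nat.le_add_right K n, ?_⟩
  by_contra hne
  exact (hK _ (Nat.le_add_right K n)).not_ge (hs.trans (h2 _ hlarge hne))
end
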